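/- arXiv:0901.2004 — 2 statements merged into one kernel-verified Lean document; each statement's English description precedes it below -/
import Mathlib

section
/- Let α ≥ 2. There is no s ∈ ℝ for which a constant C exists such that the global-in-time estimate ‖(e^{itφ(D)}u₀)²‖_{L²(ℝ_t×𝕋×ℝ)} ≤ C · ‖u₀‖_{H^{s}_x L²_y} · ‖u₀‖_{L²(𝕋×ℝ)} holds for all u₀ : 𝕋×ℝ → ℂ satisfying the mean-zero condition in x. -/
/- STATEMENT 2: failure of the global-in-time bilinear Strichartz estimate on
   𝕋×ℝ (Proposition `third`).  Functions `u₀ : 𝕋×ℝ → ℂ` are represented by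
   their partial Fourier transforms `u : ℤ → ℝ → ℂ`; `HsL2 0 u` is the
   `L²(𝕋×ℝ)` norm of `u₀` (up to a fixed Plancherel constant, which is
   irrelevant in a no-constant-exists statement). -/

noncomputable section

open MeasureTheory Complex Real
open scoped ENNReal NNReal

instance : Fact (0 < 2 * Real.pi) := ⟨by positivity⟩

abbrev Tper : Type := AddCircle (2 * Real.pi)

def jap (x : ℝ) : ℝ := Real.sqrt (1 + x ^ 2)

def phi2 (α : ℝ) (k : ℤ) (η : ℝ) : ℝ := |(k : ℝ)| ^ α * (k : ℝ) - η ^ 2 / (k : ℝ)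

def freeEvol2 (α : ℝ) (u : ℤ → ℝ → ℂ) (t : ℝ) (x : Tper) (y : ℝ) : ℂ :=
  ∑' k : ℤ, ∫ η : ℝ,
    (fourier k x) * Complex.exp (Complex.I * ((t * phi2 α k η + η * y : ℝ) : ℂ)) * u k η

def HsL2 (s : ℝ) (u : ℤ → ℝ → ℂ) : ℝ≥0∞ :=
  (∑' k : ℤ, ENNReal.ofReal (jap (k : ℝ) ^ (2 * s)) *
    ∫⁻ η : ℝ, (‖u k η‖₊ : ℝ≥0∞) ^ (2 : ℝ)) ^ ((1 : ℝ) / 2)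

def L2T2 (f : ℝ → Tper → ℝ → ℂ) : ℝ≥0∞ :=
  (∫⁻ t : ℝ, ∫⁻ x : Tper, ∫⁻ y : ℝ, (‖f t x y‖₊ : ℝ≥0∞) ^ (2 : ℝ)) ^ ((1 : ℝ) / 2)

/-- The datum carried by the mode `k = 1` whose profile in `η` is the indicator of `(0, ε]`. -/
def lowFreqDatum (ε : ℝ) (k : ℤ) (η : ℝ) : ℂ :=
  if k = 1 then (Set.Ioc 0 ε).indicator (fun _ => 1) η else 0

lemma mul_measure_le_lintegral {X : Type*} [MeasurableSpace X] {μ : Measure X} {s : Set X}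
    (hs : MeasurableSet s) {c : ℝ≥0∞} {f : X → ℝ≥0∞} (h : ∀ a ∈ s, c ≤ f a) :
    c * μ s ≤ ∫⁻ a, f a ∂μ :=
  calc c * μ s = ∫⁻ _ in s, c ∂μ := (setLIntegral_const s c).symm
    _ ≤ ∫⁻ a in s, f a ∂μ := setLIntegral_mono' hs h
    _ ≤ ∫⁻ a, f a ∂μ := setLIntegral_le_lintegral s f

lemma ENNReal.rpow_half_sq (a : ℝ≥0∞) : (a ^ ((1 : ℝ) / 2)) ^ 2 = a := by
  rw [← ENNReal.rpow_natCast, ← ENNReal.rpow_mul]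
  norm_num

lemma half_le_cos {θ : ℝ} (h : |θ| ≤ 1) : 1 / 2 ≤ Real.cos θ := by
  have h1 := Real.one_sub_sq_div_two_le_cos (x := θ)
  have h2 : θ ^ 2 ≤ 1 := (sq_le_one_iff_abs_le_one θ).2 h
  linarith

lemma half_le_norm_integral_exp {ε : ℝ} (hε : 0 ≤ ε) {θ : ℝ → ℝ} (hθ : Continuous θ)
    (h : ∀ η ∈ Set.Ioc 0 ε, |θ η| ≤ 1) :
    ε / 2 ≤ ‖∫ η in Set.Ioc 0 ε, Complex.exp (θ η * Complex.I)‖ := by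
  have hint : IntegrableOn (fun η => Complex.exp (θ η * Complex.I)) (Set.Ioc 0 ε) :=
    (Continuous.integrableOn_Icc (by fun_prop)).mono_set Set.Ioc_subset_Icc_self
  have hre : (∫ η in Set.Ioc 0 ε, Complex.exp (θ η * Complex.I)).re
      = ∫ η in Set.Ioc 0 ε, Real.cos (θ η) := by
    have := integral_re (𝕜 := ℂ) hint
    simpa [Complex.exp_ofReal_mul_I_re] using this.symm
  calc ε / 2 = ∫ _ in Set.Ioc 0 ε, (1 / 2 : ℝ) := by
        simp [hε, div_eq_mul_inv]
    _ ≤ ∫ η in Set.Ioc 0 ε, Real.cos (θ η) := by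
        refine setIntegral_mono_on (by simp) ?_ measurableSet_Ioc
          fun η hη => half_le_cos (h η hη)
        exact (Continuous.integrableOn_Icc (by fun_prop)).mono_set Set.Ioc_subset_Icc_self
    _ ≤ _ := by rw [← hre]; exact Complex.re_le_norm _

lemma norm_freeEvol2_lowFreqDatum (α ε t : ℝ) (x : Tper) (y : ℝ) :
    ‖freeEvol2 α (lowFreqDatum ε) t x y‖
      = ‖∫ η in Set.Ioc 0 ε, Complex.exp (((η * y - t * η ^ 2 : ℝ) : ℂ) * Complex.I)‖ := by
  have hsum : freeEvol2 α (lowFreqDatum ε) t x y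
      = fourier 1 x * Complex.exp (t * Complex.I) *
        ∫ η in Set.Ioc 0 ε, Complex.exp (((η * y - t * η ^ 2 : ℝ) : ℂ) * Complex.I) := by
    unfold freeEvol2
    rw [tsum_eq_single 1 (fun k hk => by simp [lowFreqDatum, hk]),
      ← integral_indicator measurableSet_Ioc, ← integral_const_mul]
    congr 1
    ext η
    by_cases hη : η ∈ Set.Ioc 0 ε
    · simp only [lowFreqDatum, if_true, Set.indicator_of_mem hη, mul_one]
      rw [mul_assoc, ← Complex.exp_add]
      congr 2
      simp only [phi2, Int.cast_one, abs_one, Real.one_rpow]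
      push_cast
      ring
    · simp [lowFreqDatum, Set.indicator_of_notMem hη]
  rw [hsum, norm_mul, norm_mul, Complex.norm_exp_ofReal_mul_I, fourier_apply, Circle.norm_coe]
  simp

lemma half_le_norm_freeEvol2_lowFreqDatum (α : ℝ) {ε t y : ℝ} (hε : 0 < ε)
    (ht : t ∈ Set.Icc 0 (1 / ε ^ 2)) (hy : y ∈ Set.Icc 0 (1 / ε)) (x : Tper) :
    ε / 2 ≤ ‖freeEvol2 α (lowFreqDatum ε) t x y‖ := by
  rw [norm_freeEvol2_lowFreqDatum]
  refine half_le_norm_integral_exp (θ := fun η => η * y - t * η ^ 2) hε.le (by fun_prop) ?_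
  rintro η ⟨h0, h1⟩
  have hy1 : η * y ≤ 1 :=
    calc η * y ≤ ε * (1 / ε) := mul_le_mul h1 hy.2 hy.1 hε.le
      _ = 1 := by field_simp
  have ht1 : t * η ^ 2 ≤ 1 :=
    calc t * η ^ 2 ≤ 1 / ε ^ 2 * ε ^ 2 :=
          mul_le_mul ht.2 (by gcongr) (by positivity) (by positivity)
      _ = 1 := by field_simp
  have hy0 : 0 ≤ η * y := mul_nonneg h0.le hy.1
  have ht0 : 0 ≤ t * η ^ 2 := mul_nonneg ht.1 (by positivity)
  rw [abs_le]
  constructor <;> linarith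

lemma HsL2_lowFreqDatum_sq (s ε : ℝ) :
    HsL2 s (lowFreqDatum ε) ^ 2
      = ENNReal.ofReal (jap 1 ^ (2 * s)) * ENNReal.ofReal ε := by
  unfold HsL2
  rw [ENNReal.rpow_half_sq, tsum_eq_single 1 (fun k hk => by simp [lowFreqDatum, hk])]
  have h : ∀ η : ℝ, (‖lowFreqDatum ε 1 η‖₊ : ℝ≥0∞) ^ (2 : ℝ)
      = (Set.Ioc 0 ε).indicator (fun _ => 1) η := by
    intro η
    by_cases hη : η ∈ Set.Ioc 0 ε
    · simp [lowFreqDatum, Set.indicator_of_mem hη]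
    · simp [lowFreqDatum, Set.indicator_of_notMem hη]
  simp_rw [h]
  rw [lintegral_indicator measurableSet_Ioc]
  simp

lemma le_L2T2_lowFreqDatum_sq (α : ℝ) {ε : ℝ} (hε : 0 < ε) :
    ENNReal.ofReal (ε / 16)
      ≤ L2T2 (fun t x y => (freeEvol2 α (lowFreqDatum ε) t x y) ^ 2) ^ 2 := by
  unfold L2T2
  rw [ENNReal.rpow_half_sq]
  have hpt : ∀ t ∈ Set.Icc 0 (1 / ε ^ 2), ∀ x : Tper, ∀ y ∈ Set.Icc 0 (1 / ε),
      ENNReal.ofReal ((ε / 2) ^ 4)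
        ≤ (‖(freeEvol2 α (lowFreqDatum ε) t x y) ^ 2‖₊ : ℝ≥0∞) ^ (2 : ℝ) := by
    intro t ht x y hy
    have h := half_le_norm_freeEvol2_lowFreqDatum α hε ht hy x
    rw [ENNReal.rpow_two, ← enorm_eq_nnnorm, ← ofReal_norm,
      ← ENNReal.ofReal_pow (norm_nonneg _), norm_pow, ← pow_mul]
    exact ENNReal.ofReal_le_ofReal (pow_le_pow_left₀ (by positivity) h 4)
  refine le_trans ?_ (mul_measure_le_lintegral measurableSet_Icc fun t ht =>
    mul_measure_le_lintegral MeasurableSet.univ fun x _ =>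
      mul_measure_le_lintegral measurableSet_Icc (hpt t ht x))
  rw [AddCircle.measure_univ, Real.volume_Icc, Real.volume_Icc, sub_zero, sub_zero,
    ← ENNReal.ofReal_mul (by positivity),
    ← ENNReal.ofReal_mul (by positivity), ← ENNReal.ofReal_mul (by positivity)]
  refine ENNReal.ofReal_le_ofReal ?_
  have : (ε / 2) ^ 4 * (1 / ε) * (2 * π) * (1 / ε ^ 2) = ε / 16 * (2 * π) := by
    field_simp
    norm_num
  rw [this]
  nlinarith [Real.pi_gt_three]

theorem no_global_strichartz_T_R (α : ℝ) (hα : 2 ≤ α) :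
    ¬ ∃ (s : ℝ) (C : ℝ≥0),
        ∀ u : ℤ → ℝ → ℂ, (∀ η, u 0 η = 0) →
          L2T2 (fun t x y => (freeEvol2 α u t x y) ^ 2)
            ≤ C * HsL2 s u * HsL2 0 u := by
  rintro ⟨s, C, h⟩
  set J : ℝ := jap 1 ^ (2 * s) with hJ
  set J₀ : ℝ := jap 1 ^ (2 * (0 : ℝ)) with hJ₀
  have hJpos : 0 ≤ J := Real.rpow_nonneg (Real.sqrt_nonneg _) _
  have hJ₀pos : 0 ≤ J₀ := Real.rpow_nonneg (Real.sqrt_nonneg _) _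
  set K : ℝ := 16 * ((C : ℝ) ^ 2 * J * J₀) with hK
  have hKpos : 0 ≤ K := by positivity
  set ε : ℝ := 1 / (K + 1) with hε
  have hεpos : 0 < ε := by positivity
  have key : ENNReal.ofReal (ε / 16) ≤ ENNReal.ofReal ((C : ℝ) ^ 2 * (J * ε) * (J₀ * ε)) :=
    calc ENNReal.ofReal (ε / 16) ≤ _ := le_L2T2_lowFreqDatum_sq α hεpos
      _ ≤ (C * HsL2 s (lowFreqDatum ε) * HsL2 0 (lowFreqDatum ε)) ^ 2 :=
          pow_le_pow_left₀ zero_le (h _ fun η => by simp [lowFreqDatum]) 2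
      _ = _ := by
          rw [mul_pow, mul_pow, HsL2_lowFreqDatum_sq, HsL2_lowFreqDatum_sq,
            ENNReal.ofReal_mul (by positivity), ENNReal.ofReal_mul (by positivity),
            ENNReal.ofReal_mul hJpos, ENNReal.ofReal_mul hJ₀pos,
            ENNReal.ofReal_pow C.coe_nonneg, ENNReal.ofReal_coe_nnreal]
  rw [ENNReal.ofReal_le_ofReal_iff (by positivity)] at key
  have hKε : K * ε = 1 - ε := by rw [hε]; field_simp; ring
  have hsq : ε ≤ K * ε * ε := by rw [hK]; linarith
  rw [hKε] at hsq
  nlinarith [mul_pos hεpos hεpos]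
end
end

section
/- Let α ≥ 2 and δ > 1/2. There is a constant C = C(α, δ) such that for every integer k ≥ 2 and every a ∈ ℝ: Σ_{k₁=1}^{k−1} ⟨ (k₁^{α+1} + (k−k₁)^{α+1})/k − a ⟩^{−δ} ≤ C; that is, the sum over positive integers k₁ with k₂ := k − k₁ > 0 of ⟨(φ₀(k₁)+φ₀(k₂))/k − a⟩^{−δ} is bounded uniformly in k and a. -/
/- STATEMENT 18: the elementary calculus fact
   `sup_{a,k} Σ_{k₁>0, k₂=k−k₁>0} ⟨(φ₀(k₁)+φ₀(k₂))/k − a⟩^{−δ} ≤ C`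
   used in the proof of the bilinear Strichartz estimate on 𝕋×ℝ. -/

noncomputable section

open Real Finset

/-- The level function `x ↦ (x ^ (α + 1) + (k - x) ^ (α + 1)) / k`, symmetric about `k / 2`. -/
def symmLevel (α k x : ℝ) : ℝ := (x ^ (α + 1) + (k - x) ^ (α + 1)) / k

lemma symmLevel_reflect (α k x : ℝ) : symmLevel α k (k - x) = symmLevel α k x := by
  simp only [symmLevel, sub_sub_cancel, add_comm]

lemma continuous_symmLevel {α : ℝ} (hα : 2 ≤ α) (k : ℝ) : Continuous (symmLevel α k) := by
  have h : 0 ≤ α + 1 := by linarith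
  unfold symmLevel
  exact ((Real.continuous_rpow_const h).add
    ((Real.continuous_rpow_const h).comp (continuous_const.sub continuous_id))).div_const k

lemma mul_le_rpow_sub_rpow {α k x : ℝ} (hα : 2 ≤ α) (hk : 2 ≤ k) (hx : k / 2 ≤ x)
    (hxk : x < k) : k * (2 * x - k) ≤ x ^ α - (k - x) ^ α := by
  have split : ∀ t : ℝ, 0 < t → t ^ α = t ^ (α - 2) * t ^ 2 := fun t ht => by
    rw [← Real.rpow_natCast t 2, ← Real.rpow_add ht]
    norm_num
  have hmono : (k - x) ^ (α - 2) ≤ x ^ (α - 2) :=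
    Real.rpow_le_rpow (by linarith) (by linarith) (by linarith)
  have hone : 1 ≤ x ^ (α - 2) := Real.one_le_rpow (by linarith) (by linarith)
  rw [split x (by linarith), split (k - x) (by linarith)]
  have h1 := mul_le_mul_of_nonneg_right hmono (sq_nonneg (k - x))
  have h2 : 0 ≤ (x ^ (α - 2) - 1) * (k * (2 * x - k)) :=
    mul_nonneg (by linarith) (mul_nonneg (by linarith) (by linarith))
  nlinarith

lemma monotoneOn_sub_quadratic {α k : ℝ} (hα : 2 ≤ α) (hk : 2 ≤ k) :
    MonotoneOn (fun x => x ^ (α + 1) + (k - x) ^ (α + 1) - (α + 1) * k * (x - k / 2) ^ 2)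
      (Set.Icc (k / 2) k) := by
  have hp : 1 ≤ α + 1 := by linarith
  have hd : ∀ x : ℝ, HasDerivAt
      (fun x => x ^ (α + 1) + (k - x) ^ (α + 1) - (α + 1) * k * (x - k / 2) ^ 2)
      ((α + 1) * (x ^ α - (k - x) ^ α - k * (2 * x - k))) x := fun x => by
    have h1 := Real.hasDerivAt_rpow_const (x := x) (Or.inr hp)
    have h2 := ((hasDerivAt_id x).const_sub k).rpow_const (p := α + 1) (Or.inr hp)
    have h3 := (((hasDerivAt_id x).sub_const (k / 2)).pow 2).const_mul ((α + 1) * k)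
    refine ((h1.add h2).sub h3).congr_deriv ?_
    simp only [add_sub_cancel_right, id]
    push_cast
    ring
  refine monotoneOn_of_deriv_nonneg (convex_Icc _ _)
    (fun x _ => (hd x).continuousAt.continuousWithinAt)
    (fun x _ => (hd x).differentiableAt.differentiableWithinAt) fun x hx => ?_
  rw [interior_Icc] at hx
  rw [(hd x).deriv]
  exact mul_nonneg (by linarith)
    (sub_nonneg.2 (mul_le_rpow_sub_rpow hα hk hx.1.le hx.2))

lemma sq_sub_le_symmLevel_sub {α k x y : ℝ} (hα : 2 ≤ α) (hk : 2 ≤ k) (hy : k / 2 ≤ y)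
    (hyx : y ≤ x) (hx : x ≤ k) : (x - y) ^ 2 ≤ symmLevel α k x - symmLevel α k y := by
  have hm := monotoneOn_sub_quadratic hα hk ⟨hy, hyx.trans hx⟩ ⟨hy.trans hyx, hx⟩ hyx
  simp only at hm
  rw [symmLevel, symmLevel, ← sub_div, le_div_iff₀ (by linarith)]
  have h1 : (x - y) ^ 2 ≤ (x - k / 2) ^ 2 - (y - k / 2) ^ 2 := by nlinarith
  have h2 : k * (x - y) ^ 2 ≤ k * ((x - k / 2) ^ 2 - (y - k / 2) ^ 2) :=
    mul_le_mul_of_nonneg_left h1 (by linarith)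
  have h3 : 0 ≤ α * (k * ((x - k / 2) ^ 2 - (y - k / 2) ^ 2)) :=
    mul_nonneg (by linarith) ((mul_nonneg (by linarith) (sq_nonneg _)).trans h2)
  nlinarith

lemma exists_sq_sub_le_abs_symmLevel_sub {α k : ℝ} (hα : 2 ≤ α) (hk : 2 ≤ k) (a : ℝ) :
    ∃ y, ∀ x, k / 2 ≤ x → x ≤ k → (x - y) ^ 2 ≤ |symmLevel α k x - a| := by
  have hkk : k / 2 ≤ k := by linarith
  rcases le_total a (symmLevel α k (k / 2)) with ha | ha
  · refine ⟨k / 2, fun x hx hxk => ?_⟩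
    have := sq_sub_le_symmLevel_sub hα hk le_rfl hx hxk
    exact le_trans (by linarith) (le_abs_self _)
  rcases le_total (symmLevel α k k) a with hb | hb
  · refine ⟨k, fun x hx hxk => ?_⟩
    have := sq_sub_le_symmLevel_sub hα hk hx hxk le_rfl
    exact le_trans (by linarith) (neg_le_abs _)
  obtain ⟨y, ⟨hy, hyk⟩, rfl⟩ :=
    intermediate_value_Icc hkk (continuous_symmLevel hα k).continuousOn ⟨ha, hb⟩
  refine ⟨y, fun x hx hxk => ?_⟩
  rcases le_total y x with h | h
  · exact (sq_sub_le_symmLevel_sub hα hk hy h hxk).trans (le_abs_self _)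
  · have := sq_sub_le_symmLevel_sub hα hk hx h hyk
    exact le_trans (by linarith) (neg_le_abs _)

lemma jap_pos (x : ℝ) : 0 < jap x := Real.sqrt_pos.2 (by positivity)

lemma jap_le_jap_of_abs_le {x y : ℝ} (h : |x| ≤ |y|) : jap x ≤ jap y :=
  Real.sqrt_le_sqrt (by linarith [sq_le_sq.2 h])

lemma add_one_le_two_mul_jap (x : ℝ) : x + 1 ≤ 2 * jap x := by
  have h : (x + 1) / 2 ≤ jap x := Real.le_sqrt_of_sq_le (by nlinarith [sq_nonneg (x - 1)])
  linarith

lemma jap_sq_rpow_neg_le {δ : ℝ} (hδ : 0 ≤ δ) (n : ℤ) (y : ℝ) :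
    jap (((n : ℝ) - y) ^ 2) ^ (-δ) ≤
      4 ^ δ * (1 / |((n - ⌊y⌋ : ℤ) : ℝ) + (-1 / 2)| ^ (2 * δ)) := by
  set m : ℝ := ((n - ⌊y⌋ : ℤ) : ℝ) + (-1 / 2) with hm
  have hm0 : 0 < |m| := by
    rw [abs_pos]
    intro h
    have h2 : (2 * (n - ⌊y⌋) : ℤ) = 1 := by
      have : (2 * ((n - ⌊y⌋ : ℤ) : ℝ)) = 1 := by linarith
      exact_mod_cast this
    omega
  have hle : |m| ^ 2 ≤ 4 * jap (((n : ℝ) - y) ^ 2) := by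
    rw [sq_abs]
    have h1 := Int.floor_le y
    have h2 := Int.lt_floor_add_one y
    have h3 := add_one_le_two_mul_jap (((n : ℝ) - y) ^ 2)
    have h4 : (m - (n - y)) ^ 2 ≤ 1 / 4 := by
      rw [hm]
      push_cast
      nlinarith
    nlinarith [sq_nonneg (m - 2 * (n - y))]
  have hrw : 4 ^ δ * (1 / |m| ^ (2 * δ)) = (|m| ^ 2 / 4) ^ (-δ) := by
    rw [Real.rpow_neg (by positivity), Real.div_rpow (by positivity) (by norm_num),
      Real.rpow_mul (abs_nonneg _), Real.rpow_ofNat]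
    field_simp
  rw [hrw]
  exact Real.rpow_le_rpow_of_nonpos (by positivity) (by linarith) (by linarith)

lemma sum_jap_sq_rpow_neg_le {δ : ℝ} (hδ : 1 / 2 < δ) (s : Finset ℕ) (y : ℝ) :
    ∑ n ∈ s, jap (((n : ℝ) - y) ^ 2) ^ (-δ) ≤
      4 ^ δ * ∑' m : ℤ, 1 / |(m : ℝ) + (-1 / 2)| ^ (2 * δ) := by
  have hs : Summable fun m : ℤ => 1 / |(m : ℝ) + (-1 / 2)| ^ (2 * δ) :=
    (Real.summable_one_div_int_add_rpow _ _).2 (by linarith)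
  have hinj : Function.Injective fun n : ℕ => (n : ℤ) - ⌊y⌋ := fun a b h => by
    simpa using h
  calc ∑ n ∈ s, jap (((n : ℝ) - y) ^ 2) ^ (-δ)
      ≤ ∑ n ∈ s, 4 ^ δ * (1 / |(((n : ℤ) - ⌊y⌋ : ℤ) : ℝ) + (-1 / 2)| ^ (2 * δ)) :=
        Finset.sum_le_sum fun n _ => by
          simpa using jap_sq_rpow_neg_le (by linarith : 0 ≤ δ) (n : ℤ) y
    _ = 4 ^ δ * ∑ m ∈ s.image fun n : ℕ => (n : ℤ) - ⌊y⌋,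
          1 / |(m : ℝ) + (-1 / 2)| ^ (2 * δ) := by
        rw [← Finset.mul_sum, Finset.sum_image hinj.injOn]
    _ ≤ _ := by
        gcongr
        exact hs.sum_le_tsum _ fun m _ => by positivity

theorem uniform_sum_bound
    (α δ : ℝ) (hα : 2 ≤ α) (hδ : 1/2 < δ) :
    ∃ C : ℝ, ∀ k : ℕ, 2 ≤ k → ∀ a : ℝ,
      ∑ k₁ ∈ Finset.Ico 1 k,
        jap (((k₁ : ℝ) ^ (α + 1) + ((k : ℝ) - (k₁ : ℝ)) ^ (α + 1)) / (k : ℝ) - a) ^ (-δ)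
          ≤ C := by
  refine ⟨4 ^ δ * (∑' m : ℤ, 1 / |(m : ℝ) + (-1 / 2)| ^ (2 * δ)) +
    4 ^ δ * ∑' m : ℤ, 1 / |(m : ℝ) + (-1 / 2)| ^ (2 * δ), fun k hk a => ?_⟩
  have hk' : (2 : ℝ) ≤ k := by exact_mod_cast hk
  obtain ⟨y, hy⟩ := exists_sq_sub_le_abs_symmLevel_sub hα hk' a
  have decay : ∀ {t u : ℝ}, t ^ 2 ≤ |u| → jap u ^ (-δ) ≤ jap (t ^ 2) ^ (-δ) := fun h =>
    Real.rpow_le_rpow_of_nonpos (jap_pos _)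
      (jap_le_jap_of_abs_le (by rwa [abs_of_nonneg (sq_nonneg _)])) (by linarith)
  refine le_trans (Finset.sum_le_sum fun n hn => ?_)
    (Finset.sum_add_distrib.trans_le (add_le_add (sum_jap_sq_rpow_neg_le hδ (Finset.Ico 1 k) y)
      (sum_jap_sq_rpow_neg_le hδ (Finset.Ico 1 k) (k - y))))
  have hnk : (n : ℝ) ≤ k := by exact_mod_cast (Finset.mem_Ico.1 hn).2.le
  have hnonneg : ∀ t : ℝ, 0 ≤ jap t ^ (-δ) := fun t => Real.rpow_nonneg (jap_pos t).le _
  change jap (symmLevel α k n - a) ^ (-δ) ≤ _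
  rcases le_total ((k : ℝ) / 2) n with h | h
  · exact (decay (hy n h hnk)).trans (le_add_of_nonneg_right (hnonneg _))
  · have hr := hy (k - n) (by linarith) (by simp)
    rw [symmLevel_reflect, show ((k : ℝ) - n - y) ^ 2 = (n - (k - y)) ^ 2 by ring] at hr
    exact (decay hr).trans (le_add_of_nonneg_left (hnonneg _))
end
end
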